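/- Let C be a locally finite, Krull-Schmidt, K-linear extriangulated category (K a field) with dim_K Hom_C(X,Y) < ∞ and dim_K E(X,Y) < ∞ for all X,Y ∈ C, and let ψ : K_0(C,0) → K_0(C) be the canonical epimorphism. Then Ker(ψ) is generated by the elements [δ] = [A] + [C] − [B] of K_0(C,0), where A → B → C --δ--> runs through all Auslander-Reiten E-triangles in C. -/

import Mathlib

open CategoryTheory CategoryTheory.Limits Opposite ZeroObject

attribute [local instance] CategoryTheory.Limits.hasBinaryBiproducts_of_finite_biproducts

universe w v u

noncomputable section

/-- An object of a preadditive category with finite biproducts is *indecomposable* if it is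
nonzero and admits no nontrivial direct sum decomposition. -/
def Indec {C : Type u} [Category.{v} C] [Preadditive C] [HasFiniteBiproducts C] (X : C) : Prop :=
  ¬ IsZero X ∧ ∀ (Y Z : C), Nonempty (X ≅ Y ⊞ Z) → IsZero Y ∨ IsZero Z

/-- A preadditive category is *Krull-Schmidt* if every object is (isomorphic to) a finite
biproduct of objects having local endomorphism rings. -/
def IsKrullSchmidt (C : Type u) [Category.{v} C] [Preadditive C] [HasFiniteBiproducts C] : Prop :=
  ∀ X : C, ∃ (n : ℕ) (f : Fin n → C),
    (∀ i, IsLocalRing (CategoryTheory.End (f i))) ∧ Nonempty (X ≅ ⨁ f)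

/-- `C` is *locally finite*: for every indecomposable `A` there are, up to isomorphism, only
finitely many indecomposables `B` with `Hom(A, B) ≠ 0`, and only finitely many indecomposables
`B` with `Hom(B, A) ≠ 0`. -/
def LocFinite (C : Type u) [Category.{v} C] [Preadditive C] [HasFiniteBiproducts C] : Prop :=
  ∀ A : C, Indec A →
    (∃ (n : ℕ) (ind : Fin n → C), ∀ B : C, Indec B → (∃ φ : A ⟶ B, φ ≠ 0) →
        ∃ i, Nonempty (B ≅ ind i)) ∧
    (∃ (n : ℕ) (ind : Fin n → C), ∀ B : C, Indec B → (∃ φ : B ⟶ A, φ ≠ 0) →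
        ∃ i, Nonempty (B ≅ ind i))

section ExtCatDef

variable (K : Type w) [Field K]
variable (C : Type u) [Category.{v} C] [Preadditive C] [Linear K C] [HasFiniteBiproducts C]

/-- An extriangulated structure (in the sense of Nakaoka–Palu) on the `K`-linear category `C`,
with `K`-linear extension groups: a biadditive functor `E : Cᵒᵖ × C → Ab` (here landing in
`K`-modules, recording the `K`-linear structure on the extension groups) together with an
additive realization `real` of extensions by conflations, satisfying (ET1)–(ET4) and their
duals. -/
structure ExtCat where
  /-- the biadditive functor `E : Cᵒᵖ × C → Ab`. -/
  E : Cᵒᵖ ⥤ C ⥤ ModuleCat.{v} K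
  additive₁ : E.Additive
  additive₂ : ∀ c : Cᵒᵖ, (E.obj c).Additive
  /-- `real x y δ` says that the sequence `x, y` realizes the extension `δ`, i.e.
  `(x, y, δ)` is an `E`-triangle. -/
  real : ∀ {a b c : C}, (a ⟶ b) → (b ⟶ c) → ((E.obj (op c)).obj a) → Prop
  /-- every extension is realized by some conflation. -/
  real_exists : ∀ {a c : C} (δ : (E.obj (op c)).obj a),
    ∃ (b : C) (x : a ⟶ b) (y : b ⟶ c), real x y δ
  /-- the realization is well defined on equivalence classes of sequences. -/
  real_congr : ∀ {a b b' c : C} {x : a ⟶ b} {y : b ⟶ c} {x' : a ⟶ b'} {y' : b' ⟶ c}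
    {δ : (E.obj (op c)).obj a} (e : b ≅ b'),
      x ≫ e.hom = x' → e.hom ≫ y' = y → real x y δ → real x' y' δ
  /-- any two realizations of the same extension are equivalent sequences. -/
  real_unique : ∀ {a b b' c : C} {x : a ⟶ b} {y : b ⟶ c} {x' : a ⟶ b'} {y' : b' ⟶ c}
    {δ : (E.obj (op c)).obj a}, real x y δ → real x' y' δ →
      ∃ e : b ≅ b', x ≫ e.hom = x' ∧ e.hom ≫ y' = y
  /-- (ET2) realization of morphisms of extensions: if `f_* δ = g^* δ'` then `(f, g)` extends to
  a morphism of the realizing `E`-triangles. -/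
  real_lift : ∀ {a b c a' b' c' : C} {x : a ⟶ b} {y : b ⟶ c} {x' : a' ⟶ b'} {y' : b' ⟶ c'}
    {δ : (E.obj (op c)).obj a} {δ' : (E.obj (op c')).obj a'} (f : a ⟶ a') (g : c ⟶ c'),
      real x y δ → real x' y' δ' →
      ((E.obj (op c)).map f) δ = ((E.map g.op).app a') δ' →
      ∃ m : b ⟶ b', x ≫ m = f ≫ x' ∧ m ≫ y' = y ≫ g
  /-- the realization is additive, part (i): split extensions are realized by split sequences. -/
  real_zero : ∀ a c : C,
    real (biprod.inl : a ⟶ a ⊞ c) (biprod.snd : a ⊞ c ⟶ c) (0 : (E.obj (op c)).obj a)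
  /-- the realization is additive, part (ii): it commutes with direct sums. -/
  real_sum : ∀ {a b c a' b' c' : C} {x : a ⟶ b} {y : b ⟶ c} {x' : a' ⟶ b'} {y' : b' ⟶ c'}
    {δ : (E.obj (op c)).obj a} {δ' : (E.obj (op c')).obj a'},
      real x y δ → real x' y' δ' →
      real (biprod.map x x') (biprod.map y y')
        (((E.map (biprod.fst : c ⊞ c' ⟶ c).op).app (a ⊞ a'))
            (((E.obj (op c)).map (biprod.inl : a ⟶ a ⊞ a')) δ) +
         ((E.map (biprod.snd : c ⊞ c' ⟶ c').op).app (a ⊞ a'))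
            (((E.obj (op c')).map (biprod.inr : a' ⟶ a ⊞ a')) δ'))
  /-- (ET3). -/
  et3 : ∀ {a b c a' b' c' : C} {x : a ⟶ b} {y : b ⟶ c} {x' : a' ⟶ b'} {y' : b' ⟶ c'}
    {δ : (E.obj (op c)).obj a} {δ' : (E.obj (op c')).obj a'} (f : a ⟶ a') (m : b ⟶ b'),
      real x y δ → real x' y' δ' → x ≫ m = f ≫ x' →
      ∃ g : c ⟶ c', y ≫ g = m ≫ y' ∧ ((E.obj (op c)).map f) δ = ((E.map g.op).app a') δ'
  /-- (ET3)ᵒᵖ. -/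
  et3op : ∀ {a b c a' b' c' : C} {x : a ⟶ b} {y : b ⟶ c} {x' : a' ⟶ b'} {y' : b' ⟶ c'}
    {δ : (E.obj (op c)).obj a} {δ' : (E.obj (op c')).obj a'} (g : c ⟶ c') (m : b ⟶ b'),
      real x y δ → real x' y' δ' → m ≫ y' = y ≫ g →
      ∃ f : a ⟶ a', x ≫ m = f ≫ x' ∧ ((E.obj (op c)).map f) δ = ((E.map g.op).app a') δ'
  /-- (ET4). -/
  et4 : ∀ {A B D F G : C} {f : A ⟶ B} {f' : B ⟶ D} {g : B ⟶ G} {g' : G ⟶ F}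
    {δ : (E.obj (op D)).obj A} {δ' : (E.obj (op F)).obj B},
      real f f' δ → real g g' δ' →
      ∃ (Eo : C) (d : D ⟶ Eo) (e : Eo ⟶ F) (h' : G ⟶ Eo) (δ'' : (E.obj (op Eo)).obj A),
        real (f ≫ g) h' δ'' ∧ f' ≫ d = g ≫ h' ∧ h' ≫ e = g' ∧
        real d e (((E.obj (op F)).map f') δ') ∧
        ((E.map d.op).app A) δ'' = δ ∧
        ((E.obj (op Eo)).map f) δ'' = ((E.map e.op).app B) δ'
  /-- (ET4)ᵒᵖ. -/
  et4op : ∀ {A B D F Cc : C} {f' : D ⟶ A} {f : A ⟶ B} {g' : F ⟶ B} {g : B ⟶ Cc}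
    {δ : (E.obj (op B)).obj D} {δ' : (E.obj (op Cc)).obj F},
      real f' f δ → real g' g δ' →
      ∃ (Eo : C) (d : D ⟶ Eo) (e : Eo ⟶ F) (h' : Eo ⟶ A) (δ'' : (E.obj (op Cc)).obj Eo),
        real h' (f ≫ g) δ'' ∧ d ≫ h' = f' ∧ h' ≫ f = e ≫ g' ∧
        real d e (((E.map g'.op).app D) δ) ∧
        ((E.obj (op Cc)).map e) δ'' = δ' ∧
        ((E.obj (op B)).map d) δ = ((E.map g.op).app Eo) δ''

end ExtCatDef

namespace ExtCat

variable {K : Type w} [Field K]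
variable {C : Type u} [Category.{v} C] [Preadditive C] [Linear K C] [HasFiniteBiproducts C]
variable (ξ : ExtCat K C)

/-- The extension group `E(c, a)`. -/
abbrev Ext (c a : C) : Type v := (ξ.E.obj (op c)).obj a

/-- Pushforward `f_* : E(c, a) → E(c, a')` along `f : a ⟶ a'`. -/
def push (c : C) {a a' : C} (f : a ⟶ a') (δ : ξ.Ext c a) : ξ.Ext c a' :=
  ((ξ.E.obj (op c)).map f) δ

/-- Pullback `g^* : E(c, a) → E(c', a)` along `g : c' ⟶ c`. -/
def pull (a : C) {c c' : C} (g : c' ⟶ c) (δ : ξ.Ext c a) : ξ.Ext c' a :=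
  ((ξ.E.map g.op).app a) δ

/-- An object `P` is projective if `E(P, A) = 0` for all `A`. -/
def ProjObj (P : C) : Prop := ∀ (A : C) (δ : ξ.Ext P A), δ = 0

/-- An object `I` is injective if `E(A, I) = 0` for all `A`. -/
def InjObj (I : C) : Prop := ∀ (A : C) (δ : ξ.Ext A I), δ = 0

end ExtCat

/-- A non-split `E`-extension `δ ∈ E(c, a)` is *almost split* if
(AS1) `f_* δ = 0` for every non-section `f : a ⟶ a'`, and
(AS2) `g^* δ = 0` for every non-retraction `g : c' ⟶ c`.
An `E`-triangle realizing an almost split extension is an Auslander–Reiten `E`-triangle. -/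
def ExtCat.AlmostSplit {K : Type w} [Field K] {C : Type u} [Category.{v} C] [Preadditive C]
    [HasFiniteBiproducts C] (ξ : ExtCat K C) {a c : C} (δ : ξ.Ext c a) : Prop :=
  δ ≠ 0 ∧
  (∀ {a' : C} (f : a ⟶ a'), (¬ ∃ r : a' ⟶ a, f ≫ r = 𝟙 a) → ξ.push c f δ = 0) ∧
  (∀ {c' : C} (g : c' ⟶ c), (¬ ∃ s : c ⟶ c', s ≫ g = 𝟙 c) → ξ.pull a g δ = 0)

section K0Defs

variable (C : Type u) [Category.{v} C] [Preadditive C] [HasFiniteBiproducts C]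

/-- The relations `[A] + [B] - [A ⊞ B]` and `[A] - [B]` for `A ≅ B`, defining `K₀(C, 0)`. -/
def relAdd : Set (FreeAbelianGroup C) :=
  {x | (∃ A B : C,
          x = FreeAbelianGroup.of A + FreeAbelianGroup.of B - FreeAbelianGroup.of (A ⊞ B)) ∨
       (∃ A B : C, Nonempty (A ≅ B) ∧ x = FreeAbelianGroup.of A - FreeAbelianGroup.of B)}

/-- `K₀(C, 0)`: the free abelian group on the isomorphism classes of objects of `C`. -/
abbrev K0Zero := FreeAbelianGroup C ⧸ AddSubgroup.closure (relAdd C)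

/-- The class `[A]` of an object `A` in `K₀(C, 0)`. -/
def clsZero (A : C) : K0Zero C := QuotientAddGroup.mk (FreeAbelianGroup.of A)

variable {K : Type w} [Field K]

/-- The set of elements `[δ] = [A] + [C] - [B]` of `K₀(C, 0)` for all `E`-triangles
`A ⟶ B ⟶ C --δ-->`. -/
def conflRel (ξ : ExtCat K C) : Set (K0Zero C) :=
  {x | ∃ (A B Cc : C) (f : A ⟶ B) (g : B ⟶ Cc) (δ : ξ.Ext Cc A),
        ξ.real f g δ ∧ x = clsZero C A + clsZero C Cc - clsZero C B}

/-- The Grothendieck group `K₀(C)` of the extriangulated category. -/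
abbrev K0Ext (ξ : ExtCat K C) := K0Zero C ⧸ AddSubgroup.closure (conflRel C ξ)

/-- The canonical epimorphism `ψ : K₀(C, 0) → K₀(C)`. -/
def psiExt (ξ : ExtCat K C) : K0Zero C →+ K0Ext C ξ := QuotientAddGroup.mk' _

/-- The class `[A]` of an object `A` in `K₀(C)`. -/
def k0clsE (ξ : ExtCat K C) (A : C) : K0Ext C ξ := psiExt C ξ (clsZero C A)

end K0Defs

/-- The set of elements `[δ] = [A] + [C] - [B]` of `K₀(C, 0)` arising from
Auslander–Reiten `E`-triangles. -/
def arRelExt {K : Type w} [Field K] (C : Type u) [Category.{v} C] [Preadditive C]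
    [HasFiniteBiproducts C] (ξ : ExtCat K C) : Set (K0Zero C) :=
  {x | ∃ (A B Cc : C) (f : A ⟶ B) (g : B ⟶ Cc) (δ : ξ.Ext Cc A),
        ξ.real f g δ ∧ ξ.AlmostSplit δ ∧ x = clsZero C A + clsZero C Cc - clsZero C B}


section Helpers

namespace ExtCat

variable {K : Type w} [Field K]
variable {C : Type u} [Category.{v} C] [Preadditive C] [HasFiniteBiproducts C]
variable (ξ : ExtCat K C)

lemma push_id {c a : C} (δ : ξ.Ext c a) : ξ.push c (𝟙 a) δ = δ := by
  simp [push]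

lemma pull_id {c a : C} (δ : ξ.Ext c a) : ξ.pull a (𝟙 c) δ = δ := by
  simp [pull]

lemma push_comp {c a a' a'' : C} (f : a ⟶ a') (g : a' ⟶ a'') (δ : ξ.Ext c a) :
    ξ.push c (f ≫ g) δ = ξ.push c g (ξ.push c f δ) := by
  simp [push]

lemma pull_comp {c c' c'' a : C} (f : c'' ⟶ c') (g : c' ⟶ c) (δ : ξ.Ext c a) :
    ξ.pull a (f ≫ g) δ = ξ.pull a f (ξ.pull a g δ) := by
  simp [pull]

lemma push_pull {c c' a a' : C} (f : a ⟶ a') (g : c' ⟶ c) (δ : ξ.Ext c a) :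
    ξ.push c' f (ξ.pull a g δ) = ξ.pull a' g (ξ.push c f δ) := by
  have := (ξ.E.map g.op).naturality f
  have := congrArg (fun t => t δ) (congrArg (fun t => (ConcreteCategory.hom t)) this)
  simpa [push, pull] using this.symm

lemma push_zero {c a a' : C} (f : a ⟶ a') : ξ.push c f (0 : ξ.Ext c a) = 0 := by
  simp [push]

lemma pull_zero {c c' a : C} (f : c' ⟶ c) : ξ.pull a f (0 : ξ.Ext c a) = 0 := by
  simp [pull]

lemma push_add {c a a' : C} (f : a ⟶ a') (δ δ' : ξ.Ext c a) :
    ξ.push c f (δ + δ') = ξ.push c f δ + ξ.push c f δ' := by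
  simp [push]

lemma pull_add {c c' a : C} (f : c' ⟶ c) (δ δ' : ξ.Ext c a) :
    ξ.pull a f (δ + δ') = ξ.pull a f δ + ξ.pull a f δ' := by
  simp [pull]

/-- pushforward as an additive map in the morphism -/
def pushHom {c a : C} (a' : C) (δ : ξ.Ext c a) : (a ⟶ a') →+ ξ.Ext c a' where
  toFun f := ξ.push c f δ
  map_zero' := by
    have := ξ.additive₂ (op c)
    simp [push]
  map_add' f g := by
    have := ξ.additive₂ (op c)
    simp [push, Functor.map_add]

/-- pullback as an additive map in the morphism -/
def pullHom {c a : C} (c' : C) (δ : ξ.Ext c a) : (c' ⟶ c) →+ ξ.Ext c' a where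
  toFun f := ξ.pull a f δ
  map_zero' := by
    have := ξ.additive₁
    simp [pull]
  map_add' f g := by
    have := ξ.additive₁
    simp [pull, Functor.map_add]

lemma pull_zero_mor {c c' a : C} (δ : ξ.Ext c a) : ξ.pull a (0 : c' ⟶ c) δ = 0 :=
  (ξ.pullHom c' δ).map_zero

lemma push_zero_mor {c a a' : C} (δ : ξ.Ext c a) : ξ.push c (0 : a ⟶ a') δ = 0 :=
  (ξ.pushHom a' δ).map_zero

lemma pull_defl {a b c : C} {x : a ⟶ b} {y : b ⟶ c} {δ : ξ.Ext c a} (h : ξ.real x y δ) :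
    ξ.pull a y δ = 0 := by
  obtain ⟨f, -, h2⟩ := ξ.et3op y (biprod.snd : (0 : C) ⊞ b ⟶ b) (ξ.real_zero 0 b) h rfl
  exact h2.symm.trans (ξ.push_zero f)

lemma push_infl {a b c : C} {x : a ⟶ b} {y : b ⟶ c} {δ : ξ.Ext c a} (h : ξ.real x y δ) :
    ξ.push c x δ = 0 := by
  obtain ⟨f, -, h2⟩ := ξ.et3 x (biprod.inl : b ⟶ b ⊞ (0 : C)) h (ξ.real_zero b 0) rfl
  exact h2.trans (ξ.pull_zero f)

lemma lift_of_pull {a b c X : C} {x : a ⟶ b} {y : b ⟶ c} {δ : ξ.Ext c a} (h : ξ.real x y δ)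
    (g : X ⟶ c) (hg : ξ.pull a g δ = 0) : ∃ t : X ⟶ b, t ≫ y = g := by
  obtain ⟨m, -, h2⟩ := ξ.real_lift (𝟙 a) g (ξ.real_zero a X) h
    ((ξ.push_zero (𝟙 a)).trans hg.symm)
  exact ⟨biprod.inr ≫ m, by simp [h2]⟩

/-- right almost split extensions can be recovered from nonzero pushforwards. -/
lemma recover {A X A' : C} {η : ξ.Ext X A}
    (has2 : ∀ {c' : C} (g : c' ⟶ X), (¬ ∃ s : X ⟶ c', s ≫ g = 𝟙 X) → ξ.pull A g η = 0)
    (f : A ⟶ A') (hf : ξ.push X f η ≠ 0) :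
    ∃ f' : A' ⟶ A, ξ.push X f' (ξ.push X f η) = η := by
  obtain ⟨Y, x, y, h⟩ := ξ.real_exists η
  obtain ⟨Y', x', y', h'⟩ := ξ.real_exists (ξ.push X f η)
  have hnr : ¬ ∃ s : X ⟶ Y', s ≫ y' = 𝟙 X := by
    rintro ⟨s, hs⟩
    apply hf
    rw [← ξ.pull_id (ξ.push X f η), ← hs, pull_comp, ξ.pull_defl h', pull_zero]
  obtain ⟨m, hm⟩ := ξ.lift_of_pull h y' (has2 y' hnr)
  obtain ⟨f', -, h2⟩ := ξ.et3op (𝟙 X) m h' h (by simpa using hm)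
  exact ⟨f', h2.trans (ξ.pull_id η)⟩

end ExtCat

variable {C : Type u} [Category.{v} C] [Preadditive C] [HasFiniteBiproducts C]

lemma cls_biprod (A B : C) : clsZero C (A ⊞ B) = clsZero C A + clsZero C B := by
  symm
  rw [← sub_eq_zero]
  exact (QuotientAddGroup.eq_zero_iff _).2 (AddSubgroup.subset_closure (Or.inl ⟨A, B, rfl⟩))

lemma cls_iso {A B : C} (e : A ≅ B) : clsZero C A = clsZero C B := by
  rw [← sub_eq_zero]
  exact (QuotientAddGroup.eq_zero_iff _).2 (AddSubgroup.subset_closure (Or.inr ⟨A, B, ⟨e⟩, rfl⟩))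

lemma cls_zero : clsZero C (0 : C) = 0 := by
  have h := cls_biprod (0 : C) (0 : C)
  have hz : IsZero ((0 : C) ⊞ (0 : C)) := by
    rw [IsZero.iff_id_eq_zero]
    apply biprod.hom_ext <;> exact (isZero_zero C).eq_of_tgt _ _
  rw [cls_iso (hz.iso (isZero_zero C))] at h
  simpa using h

lemma local_or {X : C} (hX : IsLocalRing (End X)) (u v : X ⟶ X) (h : u + v = 𝟙 X) :
    IsIso u ∨ IsIso v := by
  have := hX.isUnit_or_isUnit_of_add_one (a := (u : End X)) (b := (v : End X)) h
  rwa [isUnit_iff_isIso, isUnit_iff_isIso] at this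

lemma local_indec {X : C} (hX : IsLocalRing (End X)) : Indec X := by
  have key : ∀ Y Z : C, ∀ i : X ≅ Y ⊞ Z,
      IsIso (i.hom ≫ (biprod.fst ≫ biprod.inl) ≫ i.inv) → IsZero Z := by
    intro Y Z i hi
    rw [IsZero.iff_id_eq_zero]
    have h1 : (biprod.inr ≫ i.inv : Z ⟶ X) = 0 := by
      rw [← cancel_mono (i.hom ≫ (biprod.fst ≫ biprod.inl) ≫ i.inv)]
      simp
    have h2 : (biprod.inr : Z ⟶ Y ⊞ Z) = 0 := by
      rw [← cancel_mono i.inv, h1, zero_comp]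
    rw [← biprod.inr_snd (X := Y) (Y := Z), h2, zero_comp]
  have key' : ∀ Y Z : C, ∀ i : X ≅ Y ⊞ Z,
      IsIso (i.hom ≫ (biprod.snd ≫ biprod.inr) ≫ i.inv) → IsZero Y := by
    intro Y Z i hi
    rw [IsZero.iff_id_eq_zero]
    have h1 : (biprod.inl ≫ i.inv : Y ⟶ X) = 0 := by
      rw [← cancel_mono (i.hom ≫ (biprod.snd ≫ biprod.inr) ≫ i.inv)]
      simp
    have h2 : (biprod.inl : Y ⟶ Y ⊞ Z) = 0 := by
      rw [← cancel_mono i.inv, h1, zero_comp]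
    rw [← biprod.inl_fst (X := Y) (Y := Z), h2, zero_comp]
  refine ⟨fun h => ?_, ?_⟩
  · have := hX.toNontrivial
    exact one_ne_zero (α := End X) (h.eq_of_src _ _)
  · rintro Y Z ⟨i⟩
    rcases local_or hX (i.hom ≫ (biprod.fst ≫ biprod.inl) ≫ i.inv)
      (i.hom ≫ (biprod.snd ≫ biprod.inr) ≫ i.inv) (by
        rw [← Preadditive.comp_add, ← Preadditive.add_comp, biprod.total]; simp) with h | h
    · exact Or.inr (key Y Z i h)
    · exact Or.inl (key' Y Z i h)

variable {K : Type w} [Field K] (ξ : ExtCat K C)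

/-- the octahedron for pullbacks -/
lemma octa_pull {A B Cc X : C} {x : A ⟶ B} {y : B ⟶ Cc} {δ : ξ.Ext Cc A}
    (h : ξ.real x y δ) (c : X ⟶ Cc) :
    ∃ (Y M : C) (d : (0 : C) ⊞ A ⟶ Y) (e : Y ⟶ X) (p : Y ⟶ M) (q : M ⟶ Cc),
      ξ.real d e (ξ.push X biprod.inr (ξ.pull A c δ)) ∧
      ξ.real p q (ξ.push Cc (biprod.inr ≫ d) δ) ∧
      clsZero C M = clsZero C B + clsZero C X := by
  have h1 := ξ.real_sum (ξ.real_zero 0 X) h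
  have h2 : ξ.real (biprod.lift (𝟙 X) c) (biprod.desc (-c) (𝟙 Cc)) (0 : ξ.Ext Cc X) := by
    refine ξ.real_congr (x := biprod.inl) (y := biprod.snd)
      ⟨biprod.lift biprod.fst (biprod.fst ≫ c + biprod.snd),
        biprod.lift biprod.fst (biprod.snd - biprod.fst ≫ c), ?_, ?_⟩ ?_ ?_ (ξ.real_zero X Cc)
    · ext <;> simp
    · ext <;> simp
    · ext <;> simp
    · ext <;> simp
  obtain ⟨Y, d, e, p, δ'', r1, -, -, r2, -, r3⟩ := ξ.et4op h1 h2
  refine ⟨Y, _, d, e, p, biprod.map biprod.snd y ≫ biprod.desc (-c) (𝟙 Cc), ?_, ?_, ?_⟩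
  rotate_left 1
  · convert r1 using 1
    change ξ.push _ d (ξ.pull _ biprod.fst (ξ.push _ biprod.inl 0) +
      ξ.pull _ biprod.snd (ξ.push _ biprod.inr δ)) = ξ.pull _ _ δ'' at r3
    rw [ξ.push_zero, ξ.pull_zero, zero_add] at r3
    have := congrArg (ξ.pull Y (biprod.inr : Cc ⟶ X ⊞ Cc)) r3
    rw [← ξ.pull_comp, ← ξ.push_pull, ← ξ.pull_comp, biprod.inr_snd, ξ.pull_id,
      biprod.inr_desc, ξ.pull_id, ← ξ.push_comp] at this
    exact this
  · rw [cls_biprod, cls_biprod, cls_zero]; abel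
  · convert r2 using 1
    change _ = ξ.pull _ (biprod.lift (𝟙 X) c) (ξ.pull _ biprod.fst (ξ.push _ biprod.inl 0) +
      ξ.pull _ biprod.snd (ξ.push _ biprod.inr δ))
    rw [ξ.push_zero, ξ.pull_zero, zero_add, ← ξ.pull_comp, biprod.lift_snd, ξ.push_pull]

/-- the octahedron for pushforwards -/
lemma octa_push {A B X A' : C} {x : A ⟶ B} {y : B ⟶ X} {η : ξ.Ext X A}
    (h : ξ.real x y η) (p : A ⟶ A') :
    ∃ (Y M : C) (d : A' ⟶ Y) (e : Y ⟶ X ⊞ (0 : C)) (s : A ⟶ M) (t : M ⟶ Y),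
      ξ.real d e (ξ.pull A' biprod.fst (ξ.push X p η)) ∧
      ξ.real s t (ξ.pull A (e ≫ biprod.fst) η) ∧
      clsZero C M = clsZero C B + clsZero C A' := by
  have h1 := ξ.real_sum h (ξ.real_zero A' 0)
  have h2 : ξ.real (biprod.lift (𝟙 A) (-p)) (biprod.desc p (𝟙 A')) (0 : ξ.Ext A' A) := by
    refine ξ.real_congr (x := biprod.inl) (y := biprod.snd)
      ⟨biprod.lift biprod.fst (biprod.snd - biprod.fst ≫ p),
        biprod.lift biprod.fst (biprod.snd + biprod.fst ≫ p), ?_, ?_⟩ ?_ ?_ (ξ.real_zero A A')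
    · ext <;> simp
    · ext <;> simp
    · ext <;> simp
    · ext <;> simp
  obtain ⟨Y, d, e, h', δ'', r1, -, -, r2, -, r3⟩ := ξ.et4 h2 h1
  refine ⟨Y, _, d, e, biprod.lift (𝟙 A) (-p) ≫ biprod.map x biprod.inl, h', ?_, ?_, ?_⟩
  rotate_left 1
  · convert r1 using 1
    change ξ.push _ _ δ'' = ξ.pull _ e (ξ.pull _ biprod.fst (ξ.push _ biprod.inl η) +
      ξ.pull _ biprod.snd (ξ.push _ biprod.inr 0)) at r3
    rw [ξ.push_zero, ξ.pull_zero, add_zero] at r3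
    have := congrArg (ξ.push Y (biprod.fst : A ⊞ A' ⟶ A)) r3
    rw [← ξ.push_comp, ← ξ.pull_comp, ξ.push_pull, ← ξ.push_comp, biprod.inl_fst, ξ.push_id,
      biprod.lift_fst, ξ.push_id] at this
    exact this.symm
  · rw [cls_biprod, cls_biprod, cls_zero]; abel
  · convert r2 using 1
    change _ = ξ.push _ (biprod.desc p (𝟙 A')) (ξ.pull _ biprod.fst (ξ.push _ biprod.inl η) +
      ξ.pull _ biprod.snd (ξ.push _ biprod.inr 0))
    rw [ξ.push_zero, ξ.pull_zero, add_zero, ξ.push_pull, ← ξ.push_comp, biprod.inl_desc]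

lemma cls_split {A B X : C} {x : A ⟶ B} {y : B ⟶ X}
    (h : ξ.real x y (0 : ξ.Ext X A)) : clsZero C B = clsZero C A + clsZero C X := by
  obtain ⟨e, -⟩ := ξ.real_unique h (ξ.real_zero A X)
  rw [cls_iso e, cls_biprod]

/-- some component of a nonzero extension is nonzero (first variable) -/
lemma exists_pull_ne (hKS : IsKrullSchmidt C) {A X : C} {η : ξ.Ext X A} (hη : η ≠ 0) :
    ∃ (X' : C) (i : X' ⟶ X), IsLocalRing (End X') ∧ ξ.pull A i η ≠ 0 := by
  obtain ⟨n, f, hf, ⟨e⟩⟩ := hKS X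
  by_contra! hcon
  apply hη
  have hid : 𝟙 X = ∑ j, (e.hom ≫ biproduct.π f j) ≫ (biproduct.ι f j ≫ e.inv) := by
    have := congrArg (fun t => e.hom ≫ t ≫ e.inv) (biproduct.total (f := f))
    simp only [Preadditive.sum_comp, Preadditive.comp_sum] at this
    simpa using this.symm
  rw [← ξ.pull_id η]
  change ξ.pullHom X η (𝟙 X) = 0
  rw [hid, map_sum]
  refine Finset.sum_eq_zero fun j _ => ?_
  change ξ.pull _ _ _ = 0
  rw [ξ.pull_comp, hcon _ _ (hf j), ξ.pull_zero]

/-- some component of a nonzero extension is nonzero (second variable) -/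
lemma exists_push_ne (hKS : IsKrullSchmidt C) {A X : C} {η : ξ.Ext X A} (hη : η ≠ 0) :
    ∃ (A' : C) (p : A ⟶ A'), IsLocalRing (End A') ∧ ξ.push X p η ≠ 0 := by
  obtain ⟨n, f, hf, ⟨e⟩⟩ := hKS A
  by_contra! hcon
  apply hη
  have hid : 𝟙 A = ∑ j, (e.hom ≫ biproduct.π f j) ≫ (biproduct.ι f j ≫ e.inv) := by
    have := congrArg (fun t => e.hom ≫ t ≫ e.inv) (biproduct.total (f := f))
    simp only [Preadditive.sum_comp, Preadditive.comp_sum] at this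
    simpa using this.symm
  rw [← ξ.push_id η]
  change ξ.pushHom A η (𝟙 A) = 0
  rw [hid, map_sum]
  refine Finset.sum_eq_zero fun j _ => ?_
  change ξ.push _ _ _ = 0
  rw [ξ.push_comp, hcon _ _ (hf j), ξ.push_zero]

/-- The class of a right almost split extension lies in the subgroup generated by the
Auslander-Reiten triangles. -/
lemma as2_mem (hKS : IsKrullSchmidt C) {A B X : C} {x : A ⟶ B} {y : B ⟶ X} {η : ξ.Ext X A}
    (h : ξ.real x y η) (hη : η ≠ 0)
    (has2 : ∀ {c' : C} (g : c' ⟶ X), (¬ ∃ s : X ⟶ c', s ≫ g = 𝟙 X) → ξ.pull A g η = 0) :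
    clsZero C A + clsZero C X - clsZero C B ∈ AddSubgroup.closure (arRelExt C ξ) := by
  obtain ⟨A', p, hA', hp⟩ := exists_push_ne ξ hKS hη
  obtain ⟨Y, M, d, e, s, t, r1, r2, hM⟩ := octa_push ξ h p
  obtain ⟨q, hq⟩ := ξ.recover has2 p hp
  -- the second triangle splits
  have hz : ξ.pull A (e ≫ biprod.fst) η = 0 := by
    rw [← hq, ← ξ.push_pull, ξ.pull_comp, ξ.pull_defl r1, ξ.push_zero]
  rw [hz] at r2
  have hM' := cls_split ξ r2
  have has2' : ∀ {c' : C} (g : c' ⟶ X), (¬ ∃ s : X ⟶ c', s ≫ g = 𝟙 X) →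
      ξ.pull A' g (ξ.push X p η) = 0 := by
    intro c' g hg
    rw [← ξ.push_pull, has2 g hg, ξ.push_zero]
  have has1' : ∀ {a' : C} (f : A' ⟶ a'), (¬ ∃ r : a' ⟶ A', f ≫ r = 𝟙 A') →
      ξ.push X f (ξ.push X p η) = 0 := by
    intro a' f hf
    by_contra hne
    obtain ⟨f', hf'⟩ := ξ.recover has2' f hne
    rcases local_or hA' (f ≫ f') (𝟙 A' - f ≫ f') (by abel) with hi | hi
    · exact hf ⟨f' ≫ inv (f ≫ f'), by rw [← Category.assoc]; exact IsIso.hom_inv_id _⟩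
    · apply hp
      have h0 : ξ.push X (𝟙 A' - f ≫ f') (ξ.push X p η) = 0 := by
        change ξ.pushHom _ (ξ.push X p η) (𝟙 A' - f ≫ f') = 0
        rw [map_sub]
        change ξ.push X _ _ - ξ.push X _ _ = 0
        rw [ξ.push_id, ξ.push_comp, hf', sub_self]
      rw [← ξ.push_id (ξ.push X p η), ← IsIso.hom_inv_id (𝟙 A' - f ≫ f'), ξ.push_comp, h0,
        ξ.push_zero]
  have hcls : clsZero C A + clsZero C X - clsZero C B =
      clsZero C A' + clsZero C (X ⊞ (0 : C)) - clsZero C Y := by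
    rw [cls_biprod, cls_zero]
    have := hM.symm.trans hM'
    rw [eq_sub_of_add_eq this]
    abel
  rw [hcls]
  refine AddSubgroup.subset_closure ⟨A', Y, _, d, e, _, r1, ⟨?_, ?_, ?_⟩, rfl⟩
  · intro h0
    apply hp
    rw [← ξ.pull_id (ξ.push X p η), ← biprod.inl_fst (X := X) (Y := (0 : C)), ξ.pull_comp, h0,
      ξ.pull_zero]
  · intro a' f hf
    rw [ξ.push_pull, has1' f hf, ξ.pull_zero]
  · intro c' g hg
    rw [← ξ.pull_comp]
    apply has2'
    rintro ⟨s, hs⟩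
    refine hg ⟨biprod.fst ≫ s, ?_⟩
    apply biprod.hom_ext
    · simp [hs]
    · exact (isZero_zero C).eq_of_tgt _ _

/-- A test object for maps into `Z`. -/
lemma exists_test (hKS : IsKrullSchmidt C) (hLF : LocFinite C) (Z : C) :
    ∃ T : C, ∀ (X : C) (c : X ⟶ Z), IsLocalRing (End X) → c ≠ 0 →
      ∃ (i : X ⟶ T) (r : T ⟶ X), i ≫ r = 𝟙 X := by
  obtain ⟨n, f, hf, ⟨e⟩⟩ := hKS Z
  choose m ind hind using fun k => (hLF (f k) (local_indec (hf k))).2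
  refine ⟨⨁ (fun s : (Σ k : Fin n, Fin (m k)) => ind s.1 s.2), fun X c hX hc => ?_⟩
  have : ∃ k, c ≫ e.hom ≫ biproduct.π f k ≠ 0 := by
    by_contra! hcon
    apply hc
    rw [← cancel_mono e.hom, zero_comp]
    apply biproduct.hom_ext
    intro j
    rw [Category.assoc, hcon j, zero_comp]
  obtain ⟨k, hk⟩ := this
  obtain ⟨l, ⟨u⟩⟩ := hind k X (local_indec hX) ⟨_, hk⟩
  refine ⟨u.hom ≫ biproduct.ι (fun s : (Σ k : Fin n, Fin (m k)) => ind s.1 s.2) ⟨k, l⟩,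
    biproduct.π (fun s : (Σ k : Fin n, Fin (m k)) => ind s.1 s.2) ⟨k, l⟩ ≫ u.inv, ?_⟩
  simp

/-- every nonzero extension has a right almost split pullback. -/
lemma exists_as2 [Linear K C] (homFin : ∀ X Y : C, FiniteDimensional K (X ⟶ Y))
    (hKS : IsKrullSchmidt C) {A Z T : C} {δ : ξ.Ext Z A} (hδ : δ ≠ 0)
    (hT : ∀ (X : C) (c : X ⟶ Z), IsLocalRing (End X) → c ≠ 0 →
      ∃ (i : X ⟶ T) (r : T ⟶ X), i ≫ r = 𝟙 X) :
    ∃ (X : C) (c : X ⟶ Z), IsLocalRing (End X) ∧ ξ.pull A c δ ≠ 0 ∧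
      ∀ {c' : C} (g : c' ⟶ X), (¬ ∃ s : X ⟶ c', s ≫ g = 𝟙 X) →
        ξ.pull A g (ξ.pull A c δ) = 0 := by
  have := homFin T Z
  let V : (Σ X : C, (X ⟶ Z)) → Submodule K (T ⟶ Z) := fun s =>
    LinearMap.range (Linear.rightComp K T s.2)
  let S : Set (Σ X : C, (X ⟶ Z)) := {s | IsLocalRing (End s.1) ∧ ξ.pull A s.2 δ ≠ 0}
  have hS : S.Nonempty := by
    obtain ⟨X, i, h1, h2⟩ := exists_pull_ne ξ hKS hδ
    exact ⟨⟨X, i⟩, h1, h2⟩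
  obtain ⟨⟨X, c⟩, ⟨hX, hc⟩, hmin⟩ :=
    (InvImage.wf V (wellFounded_lt (α := Submodule K (T ⟶ Z)))).has_min S hS
  refine ⟨X, c, hX, hc, fun {c'} g hg => ?_⟩
  by_contra hne
  obtain ⟨X', i, hX', hi⟩ := exists_pull_ne ξ hKS hne
  refine hmin ⟨X', i ≫ g ≫ c⟩ ⟨hX', by simpa [ξ.pull_comp] using hi⟩ ?_
  have hle : V ⟨X', i ≫ g ≫ c⟩ ≤ V ⟨X, c⟩ := by
    rintro _ ⟨t, rfl⟩
    exact ⟨t ≫ i ≫ g, by simp⟩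
  refine lt_of_le_of_ne hle fun heq => ?_
  have hc0 : c ≠ 0 := by
    rintro rfl
    exact hc (ξ.pull_zero_mor δ)
  obtain ⟨a, r, har⟩ := hT X c hX hc0
  have hmem : r ≫ c ∈ V ⟨X', i ≫ g ≫ c⟩ := by
    rw [heq]; exact ⟨r, by simp⟩
  obtain ⟨t, ht⟩ := hmem
  have ht' : (a ≫ t ≫ i ≫ g) ≫ c = c := by
    have : t ≫ i ≫ g ≫ c = r ≫ c := by simpa using ht
    simp only [Category.assoc]
    rw [this, ← Category.assoc, har, Category.id_comp]
  rcases local_or hX (a ≫ t ≫ i ≫ g) (𝟙 X - a ≫ t ≫ i ≫ g) (by abel) with hi | hi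
  · refine hg ⟨inv (a ≫ t ≫ i ≫ g) ≫ a ≫ t ≫ i, ?_⟩
    have := IsIso.inv_hom_id (a ≫ t ≫ i ≫ g)
    simpa only [Category.assoc] using this
  · apply hc0
    rw [← cancel_epi (𝟙 X - a ≫ t ≫ i ≫ g), Preadditive.sub_comp, ht']
    simp

lemma confl_mem [Linear K C] (homFin : ∀ X Y : C, FiniteDimensional K (X ⟶ Y))
    (hKS : IsKrullSchmidt C) (hLF : LocFinite C) {A B Z : C} {x : A ⟶ B} {y : B ⟶ Z}
    {δ : ξ.Ext Z A} (h : ξ.real x y δ) :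
    clsZero C A + clsZero C Z - clsZero C B ∈ AddSubgroup.closure (arRelExt C ξ) := by
  obtain ⟨T, hT⟩ := exists_test hKS hLF Z
  have := homFin T Z
  let W : ∀ A : C, ξ.Ext Z A → Submodule K (T ⟶ Z) := fun A δ =>
    { carrier := {φ | ξ.pull A φ δ = 0}
      zero_mem' := ξ.pull_zero_mor δ
      add_mem' := by
        intro a b ha hb
        have := (ξ.pullHom T δ).map_add a b
        exact this.trans ((congrArg₂ (· + ·) ha hb).trans (add_zero 0))
      smul_mem' := by
        intro k φ hφ
        change ξ.pull A (k • φ) δ = 0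
        have e : k • φ = (k • 𝟙 T) ≫ φ := by simp
        rw [e, ξ.pull_comp, show ξ.pull A φ δ = 0 from hφ, ξ.pull_zero] }
  have main : ∀ (V : Submodule K (T ⟶ Z)) (A B : C) (x : A ⟶ B) (y : B ⟶ Z) (δ : ξ.Ext Z A),
      W A δ = V → ξ.real x y δ →
      clsZero C A + clsZero C Z - clsZero C B ∈ AddSubgroup.closure (arRelExt C ξ) := by
    intro V
    induction V using (wellFounded_gt (α := Submodule K (T ⟶ Z))).induction with
    | _ V ih =>
    intro A B x y δ hV h
    by_cases hδ : δ = 0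
    · subst hδ
      rw [cls_split ξ h, sub_self]
      exact zero_mem _
    · obtain ⟨X, c, hX, hc, has2⟩ := exists_as2 ξ homFin hKS hδ hT
      obtain ⟨Y, M, d, e, p, q, r1, r2, hM⟩ := octa_pull ξ h c
      have hc0 : c ≠ 0 := by
        rintro rfl
        exact hc (ξ.pull_zero_mor δ)
      obtain ⟨i, r, hir⟩ := hT X c hX hc0
      have hlt : V < W Y (ξ.push Z (biprod.inr ≫ d) δ) := by
        rw [← hV]
        refine lt_of_le_of_ne ?_ ?_
        · intro φ hφ
          change ξ.pull _ φ _ = 0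
          rw [← ξ.push_pull, show ξ.pull A φ δ = 0 from hφ, ξ.push_zero]
        · intro heq
          have hm : r ≫ c ∈ W Y (ξ.push Z (biprod.inr ≫ d) δ) := by
            change ξ.pull _ (r ≫ c) _ = 0
            rw [← ξ.push_pull, ξ.pull_comp, ξ.push_pull, ξ.push_comp, ξ.push_infl r1,
              ξ.pull_zero]
          rw [← heq] at hm
          apply hc
          have hm' : ξ.pull A (r ≫ c) δ = 0 := hm
          have := congrArg (ξ.pull A i) hm'
          rwa [← ξ.pull_comp, ← Category.assoc, hir, Category.id_comp, ξ.pull_zero] at this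
      have m1 := ih _ hlt Y M p q _ rfl r2
      have m2 := as2_mem ξ hKS r1 (by
          intro h0
          apply hc
          rw [← ξ.push_id (ξ.pull A c δ), ← biprod.inr_snd (X := (0 : C)) (Y := A), ξ.push_comp,
            h0, ξ.push_zero]) (by
          intro c' g hg
          rw [← ξ.push_pull, has2 g hg, ξ.push_zero])
      have := add_mem m1 m2
      rw [hM, cls_biprod, cls_zero] at this
      convert this using 1
      abel
  exact main _ A B x y δ rfl h

end Helpers

theorem stmt6 (K : Type w) [Field K] (C : Type u) [Category.{v} C] [Preadditive C]
    [Linear K C] [HasFiniteBiproducts C] (hKS : IsKrullSchmidt C) (ξ : ExtCat K C)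
    (homFin : ∀ X Y : C, FiniteDimensional K (X ⟶ Y))
    (extFin : ∀ X Y : C, FiniteDimensional K (ξ.Ext X Y))
    (hLF : LocFinite C) :
    (psiExt C ξ).ker = AddSubgroup.closure (arRelExt C ξ) := by
  unfold psiExt
  rw [QuotientAddGroup.ker_mk']
  apply le_antisymm
  · rw [AddSubgroup.closure_le]
    rintro _ ⟨A, B, Z, f, g, δ, h, rfl⟩
    exact confl_mem ξ homFin hKS hLF h
  · apply AddSubgroup.closure_mono
    rintro _ ⟨A, B, Z, f, g, δ, h, -, rfl⟩
    exact ⟨A, B, Z, f, g, δ, h, rfl⟩
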